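/- arXiv:2311.11789 — 6 statements merged into one kernel-verified Lean document; each statement's English description precedes it below -/
import Mathlib

section
/- (One-step decentralized policy improvement, m agents.) Let μ = (μ¹, …, μᵐ) be a base policy, let J : S → ℝ, and let μ̃ = (μ̃¹, …, μ̃ᵐ) be a policy such that for every agent i ∈ {1,…,m} and every x ∈ S, μ̃ⁱ(x) minimizes uⁱ ↦ ∑_{y∈S} p x (μ̃¹ x, …, μ̃^{i−1} x, uⁱ, μ^{i+1} x, …, μᵐ x) y · (g x (μ̃¹ x, …, uⁱ, …, μᵐ x) y + α·J(y)) over uⁱ ∈ Uⁱ. Then (T_μ̃ J)(x) ≤ (T_μ J)(x) for all x ∈ S. -/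
/-- Joint action in which agents j < i use the updated policy μt, agent i uses action u,
and agents j > i use the base policy μ. -/
def mixAction {m : ℕ} {S : Type*} {U : Fin m → Type*}
    (μt μ : ∀ i, S → U i) (i : Fin m) (u : U i) (x : S) : ∀ j, U j :=
  fun j => if h : j = i then cast (congrArg U h.symm) u
           else if j < i then μt j x else μ j x

/-- The joint action in which the first `k` agents follow `μt` and the remaining ones follow `μ`. -/
def prefixAction {m : ℕ} {S : Type*} {U : Fin m → Type*}
    (μt μ : ∀ i, S → U i) (k : ℕ) (x : S) : ∀ j, U j :=
  fun j => if (j : ℕ) < k then μt j x else μ j x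

theorem mixAction_updated {m : ℕ} {S : Type*} {U : Fin m → Type*}
    (μt μ : ∀ i, S → U i) (i : Fin m) (x : S) :
    mixAction μt μ i (μt i x) x = prefixAction μt μ (i + 1) x := by
  funext j
  unfold mixAction prefixAction
  by_cases h : j = i
  · subst h
    simp
  · have hiff : j < i ↔ (j : ℕ) < i + 1 := by omega
    simp only [h, dite_false, hiff]

theorem mixAction_base {m : ℕ} {S : Type*} {U : Fin m → Type*}
    (μt μ : ∀ i, S → U i) (i : Fin m) (x : S) :
    mixAction μt μ i (μ i x) x = prefixAction μt μ i x := by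
  funext j
  unfold mixAction prefixAction
  by_cases h : j = i
  · subst h
    simp
  · simp only [h, dite_false, Fin.lt_def]

/-- One-step decentralized policy improvement, m agents:
(T_μ̃ J)(x) ≤ (T_μ J)(x) for all x. -/
theorem dpi_one_step_m_agents {S : Type*} [Fintype S] [Nonempty S]
    {m : ℕ} (hm : 1 ≤ m) (U : Fin m → Type*)
    [∀ i, Fintype (U i)] [∀ i, Nonempty (U i)]
    (p g : S → (∀ i, U i) → S → ℝ) (α : ℝ) (hα0 : 0 < α) (hα1 : α < 1)
    (hp0 : ∀ x u y, 0 ≤ p x u y)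
    (hp1 : ∀ x u, ∑ y, p x u y = 1)
    (μ μt : ∀ i, S → U i) (J : S → ℝ)
    (hmin : ∀ (i : Fin m) (x : S) (u : U i),
      (∑ y, p x (mixAction μt μ i (μt i x) x) y *
          (g x (mixAction μt μ i (μt i x) x) y + α * J y))
        ≤ ∑ y, p x (mixAction μt μ i u x) y *
            (g x (mixAction μt μ i u x) y + α * J y)) :
    ∀ x : S,
      (∑ y, p x (fun i => μt i x) y * (g x (fun i => μt i x) y + α * J y))
        ≤ ∑ y, p x (fun i => μ i x) y * (g x (fun i => μ i x) y + α * J y) := by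
  intro x
  let Q : (∀ i, U i) → ℝ := fun u => ∑ y, p x u y * (g x u y + α * J y)
  have hprefix : ∀ k ≤ m, Q (prefixAction μt μ k x) ≤ Q (prefixAction μt μ 0 x) := by
    intro k
    induction k with
    | zero => exact fun _ => le_rfl
    | succ k ih =>
      intro hk
      have hstep := hmin ⟨k, hk⟩ x (μ ⟨k, hk⟩ x)
      rw [mixAction_updated, mixAction_base] at hstep
      exact hstep.trans (ih (by omega))
  have h := hprefix m le_rfl
  have hlast : prefixAction μt μ m x = fun i => μt i x := by
    funext j
    simp [prefixAction]
  have hfirst : prefixAction μt μ 0 x = fun i => μ i x := by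
    funext j
    simp [prefixAction]
  rwa [hlast, hfirst] at h
end

section
/- (Key step in Theorem 2.) Let μ = (μ¹, μ²) be a base policy with value J_μ (the unique fixed point of T_μ). Let J^ALP : S → ℝ satisfy J^ALP(x) ≤ J_μ(x) for all x ∈ S, and set β = max_{x∈S} |J_μ(x) − J^ALP(x)|. Let μ̃ = (μ̃¹, μ̃²) be a policy such that for every x ∈ S: μ̃¹(x) minimizes u¹ ↦ ∑_{y∈S} p x u¹ (μ² x) y · (g x u¹ (μ² x) y + α·J^ALP(y)) over u¹ ∈ U¹, and μ̃²(x) minimizes u² ↦ ∑_{y∈S} p x (μ̃¹ x) u² y · (g x (μ̃¹ x) u² y + α·J^ALP(y)) over u² ∈ U². Then (T_μ̃ J_μ)(x) ≤ J_μ(x) + α·β for all x ∈ S. -/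
/-- Key step in Theorem 2: (T_μ̃ J_μ)(x) ≤ J_μ(x) + α·β for all x. -/
theorem dpi_alp_key_step {S U1 U2 : Type*} [Fintype S] [Nonempty S]
    [Fintype U1] [Nonempty U1] [Fintype U2] [Nonempty U2]
    (p g : S → U1 → U2 → S → ℝ) (α : ℝ) (hα0 : 0 < α) (hα1 : α < 1)
    (hp0 : ∀ x u1 u2 y, 0 ≤ p x u1 u2 y)
    (hp1 : ∀ x u1 u2, ∑ y, p x u1 u2 y = 1)
    (μ1 : S → U1) (μ2 : S → U2) (Jμ : S → ℝ)
    (hfix : ∀ x : S,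
      Jμ x = ∑ y, p x (μ1 x) (μ2 x) y * (g x (μ1 x) (μ2 x) y + α * Jμ y))
    (JALP : S → ℝ) (hALP : ∀ x : S, JALP x ≤ Jμ x)
    (β : ℝ) (hβ : β = ⨆ x : S, |Jμ x - JALP x|)
    (μt1 : S → U1) (μt2 : S → U2)
    (hmin1 : ∀ (x : S) (u1 : U1),
      (∑ y, p x (μt1 x) (μ2 x) y * (g x (μt1 x) (μ2 x) y + α * JALP y))
        ≤ ∑ y, p x u1 (μ2 x) y * (g x u1 (μ2 x) y + α * JALP y))
    (hmin2 : ∀ (x : S) (u2 : U2),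
      (∑ y, p x (μt1 x) (μt2 x) y * (g x (μt1 x) (μt2 x) y + α * JALP y))
        ≤ ∑ y, p x (μt1 x) u2 y * (g x (μt1 x) u2 y + α * JALP y)) :
    ∀ x : S,
      (∑ y, p x (μt1 x) (μt2 x) y * (g x (μt1 x) (μt2 x) y + α * Jμ y))
        ≤ Jμ x + α * β := by
  intro x
  have hβ' : ∀ y, Jμ y ≤ JALP y + β := fun y => by
    have h : |Jμ y - JALP y| ≤ β :=
      hβ ▸ le_ciSup (f := fun z => |Jμ z - JALP z|) (Set.finite_range _).bddAbove y
    linarith [le_abs_self (Jμ y - JALP y)]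
  calc
    ∑ y, p x (μt1 x) (μt2 x) y * (g x (μt1 x) (μt2 x) y + α * Jμ y)
      ≤ ∑ y, p x (μt1 x) (μt2 x) y *
          (g x (μt1 x) (μt2 x) y + α * (JALP y + β)) := by
        gcongr with y
        · exact hp0 _ _ _ _
        · exact hβ' y
    _ = ∑ y, p x (μt1 x) (μt2 x) y * (g x (μt1 x) (μt2 x) y + α * JALP y) + α * β := by
        simp only [mul_add, ← add_assoc, Finset.sum_add_distrib, ← Finset.sum_mul, hp1,
          one_mul]
    _ ≤ ∑ y, p x (μ1 x) (μ2 x) y * (g x (μ1 x) (μ2 x) y + α * JALP y) + α * β := by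
        gcongr ?_ + _
        exact (hmin2 x (μ2 x)).trans (hmin1 x (μ1 x))
    _ ≤ ∑ y, p x (μ1 x) (μ2 x) y * (g x (μ1 x) (μ2 x) y + α * Jμ y) + α * β := by
        gcongr with y
        · exact hp0 _ _ _ _
        · exact hALP y
    _ = Jμ x + α * β := by rw [← hfix x]
end

section
/- (Theorem 2, two agents.) Let μ = (μ¹, μ²) be a base policy with value J_μ (the unique fixed point of T_μ). Let J^ALP : S → ℝ satisfy J^ALP(x) ≤ J_μ(x) for all x ∈ S, and set β = max_{x∈S} |J_μ(x) − J^ALP(x)|. Let μ̃ = (μ̃¹, μ̃²) be a policy such that for every x ∈ S: μ̃¹(x) minimizes u¹ ↦ ∑_{y∈S} p x u¹ (μ² x) y · (g x u¹ (μ² x) y + α·J^ALP(y)) over u¹ ∈ U¹, and μ̃²(x) minimizes u² ↦ ∑_{y∈S} p x (μ̃¹ x) u² y · (g x (μ̃¹ x) u² y + α·J^ALP(y)) over u² ∈ U². Then the value J_μ̃ of μ̃ (the unique fixed point of T_μ̃) satisfies J_μ̃(x) ≤ J_μ(x) + β/(1−α) for all x ∈ S. -/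
/-- A supersolution up to `β` of a discounted evaluation equation bounds its fixed point up to
`β / (1 - α)`. -/
theorem le_add_div_of_discounted_supersolution {S : Type*} [Fintype S]
    (w c : S → S → ℝ) {α β : ℝ} (hα0 : 0 ≤ α) (hα1 : α < 1)
    (hw0 : ∀ x y, 0 ≤ w x y) (hw1 : ∀ x, ∑ y, w x y = 1) {V J : S → ℝ}
    (hV : ∀ x, V x = ∑ y, w x y * (c x y + α * V y))
    (hJ : ∀ x, ∑ y, w x y * (c x y + α * J y) ≤ J x + β) (x : S) :
    V x ≤ J x + β / (1 - α) := by
  have : Nonempty S := ⟨x⟩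
  obtain ⟨z, hz⟩ := Finite.exists_max (fun y => V y - J y)
  have hbound : V z ≤ J z + β + α * (V z - J z) :=
    calc V z = ∑ y, w z y * (c z y + α * V y) := hV z
      _ ≤ ∑ y, (w z y * (c z y + α * J y) + w z y * (α * (V z - J z))) := by
          refine Finset.sum_le_sum fun y _ => ?_
          rw [← mul_add]
          refine mul_le_mul_of_nonneg_left ?_ (hw0 z y)
          linarith [mul_le_mul_of_nonneg_left (hz y) hα0]
      _ = ∑ y, w z y * (c z y + α * J y) + α * (V z - J z) := by
          rw [Finset.sum_add_distrib, ← Finset.sum_mul, hw1, one_mul]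
      _ ≤ J z + β + α * (V z - J z) := by linarith [hJ z]
  have hmax : V z - J z ≤ β / (1 - α) := by
    rw [le_div_iff₀ (sub_pos.2 hα1)]
    linarith
  linarith [hz x]

/-- Theorem 2, two agents: J_μ̃(x) ≤ J_μ(x) + β/(1−α) for all x. -/
theorem theorem2_two_agents {S U1 U2 : Type*} [Fintype S] [Nonempty S]
    [Fintype U1] [Nonempty U1] [Fintype U2] [Nonempty U2]
    (p g : S → U1 → U2 → S → ℝ) (α : ℝ) (hα0 : 0 < α) (hα1 : α < 1)
    (hp0 : ∀ x u1 u2 y, 0 ≤ p x u1 u2 y)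
    (hp1 : ∀ x u1 u2, ∑ y, p x u1 u2 y = 1)
    (μ1 : S → U1) (μ2 : S → U2) (Jμ : S → ℝ)
    (hfixμ : ∀ x : S,
      Jμ x = ∑ y, p x (μ1 x) (μ2 x) y * (g x (μ1 x) (μ2 x) y + α * Jμ y))
    (JALP : S → ℝ) (hALP : ∀ x : S, JALP x ≤ Jμ x)
    (β : ℝ) (hβ : β = ⨆ x : S, |Jμ x - JALP x|)
    (μt1 : S → U1) (μt2 : S → U2)
    (hmin1 : ∀ (x : S) (u1 : U1),
      (∑ y, p x (μt1 x) (μ2 x) y * (g x (μt1 x) (μ2 x) y + α * JALP y))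
        ≤ ∑ y, p x u1 (μ2 x) y * (g x u1 (μ2 x) y + α * JALP y))
    (hmin2 : ∀ (x : S) (u2 : U2),
      (∑ y, p x (μt1 x) (μt2 x) y * (g x (μt1 x) (μt2 x) y + α * JALP y))
        ≤ ∑ y, p x (μt1 x) u2 y * (g x (μt1 x) u2 y + α * JALP y))
    (Jt : S → ℝ)
    (hfixt : ∀ x : S,
      Jt x = ∑ y, p x (μt1 x) (μt2 x) y * (g x (μt1 x) (μt2 x) y + α * Jt y)) :
    ∀ x : S, Jt x ≤ Jμ x + β / (1 - α) := by
  have hgap (x : S) : Jμ x ≤ JALP x + β := by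
    have h : |Jμ x - JALP x| ≤ β :=
      hβ ▸ le_ciSup (f := fun x => |Jμ x - JALP x|) (Set.finite_range _).bddAbove x
    linarith [le_abs_self (Jμ x - JALP x)]
  have hsuper (x : S) :
      ∑ y, p x (μt1 x) (μt2 x) y * (g x (μt1 x) (μt2 x) y + α * JALP y) ≤ JALP x + β :=
    calc _ ≤ _ := hmin2 x (μ2 x)
      _ ≤ _ := hmin1 x (μ1 x)
      _ ≤ ∑ y, p x (μ1 x) (μ2 x) y * (g x (μ1 x) (μ2 x) y + α * Jμ y) := by
          gcongr with y
          · exact hp0 _ _ _ _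
          · exact hALP y
      _ = Jμ x := (hfixμ x).symm
      _ ≤ JALP x + β := hgap x
  intro x
  have h := le_add_div_of_discounted_supersolution
    (fun x => p x (μt1 x) (μt2 x)) (fun x => g x (μt1 x) (μt2 x)) hα0.le hα1
    (fun x => hp0 x _ _) (fun x => hp1 x _ _) hfixt hsuper x
  linarith [hALP x]
end

section
/- (Theorem 2, m agents.) Let μ = (μ¹, …, μᵐ) be a base policy with value J_μ (the unique fixed point of T_μ). Let J^ALP : S → ℝ satisfy J^ALP(x) ≤ J_μ(x) for all x ∈ S, and set β = max_{x∈S} |J_μ(x) − J^ALP(x)|. Let μ̃ = (μ̃¹, …, μ̃ᵐ) be a policy such that for every agent i ∈ {1,…,m} and every x ∈ S, μ̃ⁱ(x) minimizes uⁱ ↦ ∑_{y∈S} p x (μ̃¹ x, …, μ̃^{i−1} x, uⁱ, μ^{i+1} x, …, μᵐ x) y · (g x (μ̃¹ x, …, uⁱ, …, μᵐ x) y + α·J^ALP(y)) over uⁱ ∈ Uⁱ. Then the value J_μ̃ of μ̃ (the unique fixed point of T_μ̃) satisfies J_μ̃(x) ≤ J_μ(x) + β/(1−α) for all x ∈ S.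 -/
/-- If replacing the base action of each agent in turn by its updated action never increases
`Q`, then the fully updated joint action is at least as good as the base one. -/
theorem le_of_agentwise_le {m : ℕ} {S : Type*} {U : Fin m → Type*}
    (μt μ : ∀ i, S → U i) (x : S) (Q : (∀ i, U i) → ℝ)
    (hQ : ∀ i, Q (mixAction μt μ i (μt i x) x) ≤ Q (mixAction μt μ i (μ i x) x)) :
    Q (fun i => μt i x) ≤ Q (fun i => μ i x) := by
  have key : ∀ k ≤ m, Q (prefixAction μt μ k x) ≤ Q (fun i => μ i x) := by
    intro k
    induction k with
    | zero => simp +unfoldPartialApp [prefixAction]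
    | succ k ih =>
      intro hk
      have h := hQ ⟨k, hk⟩
      rw [mixAction_updated, mixAction_base] at h
      exact h.trans (ih (by omega))
  simpa +unfoldPartialApp [prefixAction] using key m le_rfl

theorem sum_bellman_mono {S : Type*} [Fintype S] {q c J J' : S → ℝ} {α : ℝ} (hα : 0 ≤ α)
    (hq : ∀ y, 0 ≤ q y) (hJ : ∀ y, J y ≤ J' y) :
    ∑ y, q y * (c y + α * J y) ≤ ∑ y, q y * (c y + α * J' y) := by
  gcongr with y
  · exact hq y
  · exact hJ y

theorem sum_bellman_add_const {S : Type*} [Fintype S] {q c J : S → ℝ} {α : ℝ}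
    (hq : ∑ y, q y = 1) (b : ℝ) :
    ∑ y, q y * (c y + α * (J y + b)) = ∑ y, q y * (c y + α * J y) + α * b := by
  calc ∑ y, q y * (c y + α * (J y + b))
      = ∑ y, (q y * (c y + α * J y) + q y * (α * b)) :=
        Finset.sum_congr rfl fun y _ => by ring
    _ = _ := by rw [Finset.sum_add_distrib, ← Finset.sum_mul, hq, one_mul]

/-- Theorem 2, m agents: J_μ̃(x) ≤ J_μ(x) + β/(1−α) for all x. -/
theorem theorem2_m_agents {S : Type*} [Fintype S] [Nonempty S]
    {m : ℕ} (hm : 1 ≤ m) (U : Fin m → Type*)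
    [∀ i, Fintype (U i)] [∀ i, Nonempty (U i)]
    (p g : S → (∀ i, U i) → S → ℝ) (α : ℝ) (hα0 : 0 < α) (hα1 : α < 1)
    (hp0 : ∀ x u y, 0 ≤ p x u y)
    (hp1 : ∀ x u, ∑ y, p x u y = 1)
    (μ μt : ∀ i, S → U i) (Jμ : S → ℝ)
    (hfixμ : ∀ x : S,
      Jμ x = ∑ y, p x (fun i => μ i x) y * (g x (fun i => μ i x) y + α * Jμ y))
    (JALP : S → ℝ) (hALP : ∀ x : S, JALP x ≤ Jμ x)
    (β : ℝ) (hβ : β = ⨆ x : S, |Jμ x - JALP x|)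
    (hmin : ∀ (i : Fin m) (x : S) (u : U i),
      (∑ y, p x (mixAction μt μ i (μt i x) x) y *
          (g x (mixAction μt μ i (μt i x) x) y + α * JALP y))
        ≤ ∑ y, p x (mixAction μt μ i u x) y *
            (g x (mixAction μt μ i u x) y + α * JALP y))
    (Jt : S → ℝ)
    (hfixt : ∀ x : S,
      Jt x = ∑ y, p x (fun i => μt i x) y * (g x (fun i => μt i x) y + α * Jt y)) :
    ∀ x : S, Jt x ≤ Jμ x + β / (1 - α) := by
  have hβle : ∀ x, |Jμ x - JALP x| ≤ β := fun x => by
    rw [hβ]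
    exact le_ciSup (f := fun x => |Jμ x - JALP x|) (Set.finite_range _).bddAbove x
  obtain ⟨x₀, hx₀⟩ := Finite.exists_max fun x => Jt x - Jμ x
  have hβ0 : 0 ≤ β := (abs_nonneg _).trans (hβle x₀)
  have hJt : ∀ y, Jt y ≤ JALP y + (β + (Jt x₀ - Jμ x₀)) := fun y => by
    linarith [hx₀ y, le_of_abs_le (hβle y)]
  have himprove := le_of_agentwise_le μt μ x₀
    (fun u => ∑ y, p x₀ u y * (g x₀ u y + α * JALP y)) fun i => hmin i x₀ (μ i x₀)
  have hbase := sum_bellman_mono (c := g x₀ fun i => μ i x₀) hα0.le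
    (hp0 x₀ fun i => μ i x₀) hALP
  have hupdated := sum_bellman_mono (c := g x₀ fun i => μt i x₀) hα0.le
    (hp0 x₀ fun i => μt i x₀) hJt
  rw [sum_bellman_add_const (hp1 _ _), ← hfixt] at hupdated
  rw [← hfixμ] at hbase
  have hgap : Jt x₀ - Jμ x₀ ≤ β / (1 - α) := by
    rw [le_div_iff₀ (by linarith)]
    nlinarith
  intro x
  linarith [hx₀ x]
end

section
/- (Inductive step of Theorem 1, two agents.) Fix a stage k and β ≥ 0. Let π have stage-k policy μ_k = (μ_k¹, μ_k²) and exact cost-to-go functions J_{k,π}, J_{k+1,π}; let π̃ have stage-k policy μ̃_k = (μ̃_k¹, μ̃_k²) and cost-to-go functions J_{k,π̃}, J_{k+1,π̃}, where J_{k,π}(x) = ∑_{y∈S} p x (μ_k¹ x)(μ_k² x) y · (g x (μ_k¹ x)(μ_k² x) y + J_{k+1,π}(y)) and J_{k,π̃}(x) = ∑_{y∈S} p x (μ̃_k¹ x)(μ̃_k² x) y · (g x (μ̃_k¹ x)(μ̃_k² x) y + J_{k+1,π̃}(y)). Let J^ALP_{k+1,π} : S → ℝ satisfy J^ALP_{k+1,π}(y)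 ≤ J_{k+1,π}(y) and |J_{k+1,π}(y) − J^ALP_{k+1,π}(y)| ≤ β for all y ∈ S. Suppose (induction hypothesis) J_{k+1,π̃}(y) ≤ J_{k+1,π}(y) + (N−k−1)·β for all y ∈ S with N−k−1 ≥ 0, and suppose for every x ∈ S: μ̃_k¹(x) minimizes u¹ ↦ ∑_{y∈S} p x u¹ (μ_k² x) y · (g x u¹ (μ_k² x) y + J^ALP_{k+1,π}(y)) over u¹ ∈ U¹, and μ̃_k²(x) minimizes u² ↦ ∑_{y∈S} p x (μ̃_k¹ x) u² y · (g x (μ̃_k¹ x) u² y + J^ALP_{k+1,π}(y)) over u² ∈ U². Then J_{k,π̃}(x) ≤ J_{k,π}(x) + (N−k)·β for all x ∈ S. -/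
/-- If `V ≤ W + c` pointwise, then the expected cost with terminal value `V` exceeds the one with
terminal value `W` by at most `c`. -/
theorem expected_cost_le_add {S : Type*} [Fintype S] {q c V W : S → ℝ} {d : ℝ}
    (hq0 : ∀ y, 0 ≤ q y) (hq1 : ∑ y, q y = 1) (hVW : ∀ y, V y ≤ W y + d) :
    ∑ y, q y * (c y + V y) ≤ ∑ y, q y * (c y + W y) + d := by
  calc ∑ y, q y * (c y + V y) ≤ ∑ y, (q y * (c y + W y) + q y * d) :=
        Finset.sum_le_sum fun y _ => by
          rw [← mul_add]
          exact mul_le_mul_of_nonneg_left (by linarith [hVW y]) (hq0 y)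
    _ = ∑ y, q y * (c y + W y) + d := by
        rw [Finset.sum_add_distrib, ← Finset.sum_mul, hq1, one_mul]

/-- Inductive step of Theorem 1, two agents:
J_{k,π̃}(x) ≤ J_{k,π}(x) + (N−k)·β for all x. -/
theorem theorem1_inductive_step {S U1 U2 : Type*} [Fintype S] [Nonempty S]
    [Fintype U1] [Nonempty U1] [Fintype U2] [Nonempty U2]
    (p g : S → U1 → U2 → S → ℝ)
    (hp0 : ∀ x u1 u2 y, 0 ≤ p x u1 u2 y)
    (hp1 : ∀ x u1 u2, ∑ y, p x u1 u2 y = 1)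
    (N k : ℕ) (hk : k + 1 ≤ N)
    (β : ℝ) (hβ : 0 ≤ β)
    (μk1 : S → U1) (μk2 : S → U2) (μtk1 : S → U1) (μtk2 : S → U2)
    (Jkπ Jk1π Jkπt Jk1πt JALPk1π : S → ℝ)
    (hJkπ : ∀ x : S,
      Jkπ x = ∑ y, p x (μk1 x) (μk2 x) y * (g x (μk1 x) (μk2 x) y + Jk1π y))
    (hJkπt : ∀ x : S,
      Jkπt x = ∑ y, p x (μtk1 x) (μtk2 x) y * (g x (μtk1 x) (μtk2 x) y + Jk1πt y))
    (hALPle : ∀ y : S, JALPk1π y ≤ Jk1π y)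
    (hALPerr : ∀ y : S, |Jk1π y - JALPk1π y| ≤ β)
    (hIH : ∀ y : S, Jk1πt y ≤ Jk1π y + ((N - k - 1 : ℕ) : ℝ) * β)
    (hmin1 : ∀ (x : S) (u1 : U1),
      (∑ y, p x (μtk1 x) (μk2 x) y * (g x (μtk1 x) (μk2 x) y + JALPk1π y))
        ≤ ∑ y, p x u1 (μk2 x) y * (g x u1 (μk2 x) y + JALPk1π y))
    (hmin2 : ∀ (x : S) (u2 : U2),
      (∑ y, p x (μtk1 x) (μtk2 x) y * (g x (μtk1 x) (μtk2 x) y + JALPk1π y))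
        ≤ ∑ y, p x (μtk1 x) u2 y * (g x (μtk1 x) u2 y + JALPk1π y)) :
    ∀ x : S, Jkπt x ≤ Jkπ x + ((N - k : ℕ) : ℝ) * β := by
  intro x
  have hstep : ((N - k : ℕ) : ℝ) = ((N - k - 1 : ℕ) : ℝ) + 1 := by
    exact_mod_cast (by omega : N - k = N - k - 1 + 1)
  have hALP : ∀ y, Jk1πt y ≤ JALPk1π y + ((N - k : ℕ) : ℝ) * β := fun y => by
    rw [hstep]
    linarith [hIH y, (abs_le.mp (hALPerr y)).2]
  rw [hJkπt, hJkπ]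
  calc _ ≤ ∑ y, p x (μtk1 x) (μtk2 x) y * (g x (μtk1 x) (μtk2 x) y + JALPk1π y)
          + ((N - k : ℕ) : ℝ) * β :=
        expected_cost_le_add (hp0 _ _ _) (hp1 _ _ _) hALP
    _ ≤ ∑ y, p x (μk1 x) (μk2 x) y * (g x (μk1 x) (μk2 x) y + JALPk1π y)
          + ((N - k : ℕ) : ℝ) * β :=
        add_le_add_left ((hmin2 x (μk2 x)).trans (hmin1 x (μk1 x))) _
    _ ≤ _ := by
        gcongr with y
        · exact hp0 _ _ _ _
        · exact hALPle y
end

section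
/- (Theorem 1, two agents.) Let N ≥ 1 and let the base policy π = (μ_0, …, μ_{N−1}) and roll-out policy π̃ = (μ̃_0, …, μ̃_{N−1}) be sequences of stage policies μ_k = (μ_k¹, μ_k²), μ̃_k = (μ̃_k¹, μ̃_k²). Define their exact cost-to-go functions backward by J_{N,π} = J_{N,π̃} = g_N and, for k = N−1, …, 0, J_{k,π}(x) = ∑_{y∈S} p x (μ_k¹ x)(μ_k² x) y · (g x (μ_k¹ x)(μ_k² x) y + J_{k+1,π}(y)) and J_{k,π̃}(x) = ∑_{y∈S} p x (μ̃_k¹ x)(μ̃_k² x) y · (g x (μ̃_k¹ x)(μ̃_k² x) y + J_{k+1,π̃}(y)). Let β ≥ 0 and for each k ∈ {0,…,N−1} let J^ALP_{k+1,π} : S → ℝ satisfy J^ALP_{k+1,π}(y) ≤ J_{k+1,π}(y) and |J_{k+1,π}(y) − J^ALP_{k+1,π}(y)| ≤ β for all y ∈ S. Suppose for every k ∈ {0,…,N−1} and every x ∈ S: μ̃_k¹(x) minimizes u¹ ↦ ∑_{y∈S} p x u¹ (μ_k² x) y · (g x u¹ (μ_k² x) y + J^ALP_{k+1,π}(y))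 over u¹ ∈ U¹, and μ̃_k²(x) minimizes u² ↦ ∑_{y∈S} p x (μ̃_k¹ x) u² y · (g x (μ̃_k¹ x) u² y + J^ALP_{k+1,π}(y)) over u² ∈ U². Then for every k ∈ {0,…,N} and every x ∈ S, J_{k,π̃}(x) ≤ J_{k,π}(x) + (N−k)·β. -/
/-- Theorem 1, two agents: for every k ∈ {0,…,N} and every x ∈ S,
J_{k,π̃}(x) ≤ J_{k,π}(x) + (N−k)·β. -/
theorem theorem1_two_agents {S U1 U2 : Type*} [Fintype S] [Nonempty S]
    [Fintype U1] [Nonempty U1] [Fintype U2] [Nonempty U2]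
    (p g : S → U1 → U2 → S → ℝ)
    (hp0 : ∀ x u1 u2 y, 0 ≤ p x u1 u2 y)
    (hp1 : ∀ x u1 u2, ∑ y, p x u1 u2 y = 1)
    (N : ℕ) (hN : 1 ≤ N)
    (μ1 μt1 : ℕ → S → U1) (μ2 μt2 : ℕ → S → U2)
    (gN : S → ℝ)
    (Jπ Jπt : ℕ → S → ℝ)
    (hJπN : ∀ x : S, Jπ N x = gN x)
    (hJπtN : ∀ x : S, Jπt N x = gN x)
    (hJπ : ∀ k < N, ∀ x : S,
      Jπ k x = ∑ y, p x (μ1 k x) (μ2 k x) y * (g x (μ1 k x) (μ2 k x) y + Jπ (k+1) y))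
    (hJπt : ∀ k < N, ∀ x : S,
      Jπt k x = ∑ y, p x (μt1 k x) (μt2 k x) y *
        (g x (μt1 k x) (μt2 k x) y + Jπt (k+1) y))
    (β : ℝ) (hβ : 0 ≤ β)
    (JALP : ℕ → S → ℝ)
    (hALPle : ∀ k < N, ∀ y : S, JALP (k+1) y ≤ Jπ (k+1) y)
    (hALPerr : ∀ k < N, ∀ y : S, |Jπ (k+1) y - JALP (k+1) y| ≤ β)
    (hmin1 : ∀ k < N, ∀ (x : S) (u1 : U1),
      (∑ y, p x (μt1 k x) (μ2 k x) y * (g x (μt1 k x) (μ2 k x) y + JALP (k+1) y))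
        ≤ ∑ y, p x u1 (μ2 k x) y * (g x u1 (μ2 k x) y + JALP (k+1) y))
    (hmin2 : ∀ k < N, ∀ (x : S) (u2 : U2),
      (∑ y, p x (μt1 k x) (μt2 k x) y * (g x (μt1 k x) (μt2 k x) y + JALP (k+1) y))
        ≤ ∑ y, p x (μt1 k x) u2 y * (g x (μt1 k x) u2 y + JALP (k+1) y)) :
    ∀ k ≤ N, ∀ x : S, Jπt k x ≤ Jπ k x + ((N - k : ℕ) : ℝ) * β := by
  intro k hk
  induction hk using Nat.decreasingInduction with
  | self => intro x; simp [hJπN, hJπtN]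
  | of_succ k hk ih =>
    intro x
    have hcast : ((N - k : ℕ) : ℝ) = ((N - (k + 1) : ℕ) : ℝ) + 1 := by
      rw [← Nat.cast_add_one]
      congr 1
      omega
    have hstep : ∀ y, Jπt (k + 1) y ≤ JALP (k + 1) y + ((N - k : ℕ) : ℝ) * β := by
      intro y
      have h1 := ih y
      have h2 := le_of_abs_le (hALPerr k hk y)
      rw [hcast]
      linarith
    calc Jπt k x
        ≤ ∑ y, p x (μt1 k x) (μt2 k x) y *
            (g x (μt1 k x) (μt2 k x) y + (JALP (k + 1) y + ((N - k : ℕ) : ℝ) * β)) := by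
          rw [hJπt k hk x]
          gcongr with y
          · exact hp0 _ _ _ _
          · exact hstep y
      _ = (∑ y, p x (μt1 k x) (μt2 k x) y *
            (g x (μt1 k x) (μt2 k x) y + JALP (k + 1) y)) + ((N - k : ℕ) : ℝ) * β := by
          simp only [← add_assoc, mul_add _ _ (_ * β), Finset.sum_add_distrib,
            ← Finset.sum_mul, hp1, one_mul]
      _ ≤ (∑ y, p x (μ1 k x) (μ2 k x) y *
            (g x (μ1 k x) (μ2 k x) y + JALP (k + 1) y)) + ((N - k : ℕ) : ℝ) * β := by
          gcongr ?_ + _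
          exact (hmin2 k hk x (μ2 k x)).trans (hmin1 k hk x (μ1 k x))
      _ ≤ Jπ k x + ((N - k : ℕ) : ℝ) * β := by
          rw [hJπ k hk x]
          gcongr with y
          · exact hp0 _ _ _ _
          · exact hALPle k hk y
end
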